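/- Let L > 0 and let (η_t)_{t≥0} be nonnegative stepsizes. Suppose there exists a constant c > 0 such that for infinitely many T ∈ ℕ one has η_T ≥ 2/L, ∑_{t=0}^{T−1} η_t ≥ 1/L, and η_T / ∑_{t=0}^{T−1} η_t ≥ c. Then for every function φ : ℕ → ℝ with φ(T) → 0 as T → ∞, it is NOT the case that for every convex L-smooth function f : ℝ → ℝ attaining its infimum at some x* and every initialization x₀ ∈ ℝ, the gradient descent iterates satisfy f(x_T) − f(x*) ≤ φ(T)·L·(x₀ − x*)² for all T ∈ ℕ. -/

import Mathlib

/-- The one-sided Huber function with curvature `L` on `(-∞, 1]` and slope `L` on `[1, ∞)`. -/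
noncomputable def oneSidedHuber (L x : ℝ) : ℝ := ∫ t in (0 : ℝ)..x, L * min t 1

lemma continuous_mul_min_one (L : ℝ) : Continuous fun t : ℝ => L * min t 1 := by
  fun_prop

lemma hasDerivAt_oneSidedHuber (L x : ℝ) : HasDerivAt (oneSidedHuber L) (L * min x 1) x :=
  (continuous_mul_min_one L).integral_hasStrictDerivAt 0 x |>.hasDerivAt

lemma deriv_oneSidedHuber (L x : ℝ) : deriv (oneSidedHuber L) x = L * min x 1 :=
  (hasDerivAt_oneSidedHuber L x).deriv

lemma differentiable_oneSidedHuber (L : ℝ) : Differentiable ℝ (oneSidedHuber L) :=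
  fun x => (hasDerivAt_oneSidedHuber L x).differentiableAt

lemma convexOn_oneSidedHuber {L : ℝ} (hL : 0 ≤ L) : ConvexOn ℝ Set.univ (oneSidedHuber L) := by
  refine Monotone.convexOn_univ_of_deriv (differentiable_oneSidedHuber L) ?_
  intro x y hxy
  simp only [deriv_oneSidedHuber]
  gcongr

lemma abs_deriv_oneSidedHuber_sub_le {L : ℝ} (hL : 0 ≤ L) (y z : ℝ) :
    |deriv (oneSidedHuber L) y - deriv (oneSidedHuber L) z| ≤ L * |y - z| := by
  simp only [deriv_oneSidedHuber]
  rw [← mul_sub, abs_mul, abs_of_nonneg hL]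
  refine mul_le_mul_of_nonneg_left ?_ hL
  simpa using abs_min_sub_min_le_max y 1 z 1

lemma oneSidedHuber_zero (L : ℝ) : oneSidedHuber L 0 = 0 := by
  simp [oneSidedHuber]

lemma oneSidedHuber_of_nonpos (L : ℝ) {x : ℝ} (hx : x ≤ 0) :
    oneSidedHuber L x = L / 2 * x ^ 2 := by
  have h : oneSidedHuber L x = ∫ t in (0 : ℝ)..x, L * t := by
    refine intervalIntegral.integral_congr fun t ht => ?_
    rw [Set.uIcc_of_ge hx] at ht
    simp only [min_eq_left (ht.2.trans zero_le_one)]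
  rw [h, intervalIntegral.integral_const_mul, integral_id]
  ring

lemma oneSidedHuber_nonneg {L : ℝ} (hL : 0 ≤ L) (x : ℝ) : 0 ≤ oneSidedHuber L x := by
  rcases le_total x 0 with hx | hx
  · rw [oneSidedHuber_of_nonpos L hx]
    positivity
  · exact intervalIntegral.integral_nonneg hx fun t ht =>
      mul_nonneg hL (le_min ht.1 zero_le_one)

/-- As long as gradient descent stays in the linear part, it moves at constant speed `L`. -/
lemma gd_oneSidedHuber_eq {L : ℝ} (hL : 0 ≤ L) {η x : ℕ → ℝ} (hη : ∀ t, 0 ≤ η t) (T : ℕ)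
    (h0 : x 0 = 1 + L * ∑ t ∈ Finset.range T, η t)
    (hx : ∀ t, x (t + 1) = x t - η t * deriv (oneSidedHuber L) (x t)) {n : ℕ} (hn : n ≤ T) :
    x n = 1 + L * (∑ t ∈ Finset.range T, η t - ∑ t ∈ Finset.range n, η t) := by
  induction n with
  | zero => simpa using h0
  | succ n ih =>
    have hxn := ih (by omega)
    have hsum : ∑ t ∈ Finset.range n, η t ≤ ∑ t ∈ Finset.range T, η t :=
      Finset.sum_le_sum_of_subset_of_nonneg (Finset.range_mono (by omega)) fun t _ _ => hη t
    have hone : 1 ≤ x n := by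
      rw [hxn]
      linarith [mul_nonneg hL (sub_nonneg.2 hsum)]
    rw [hx, deriv_oneSidedHuber, min_eq_right hone, hxn, Finset.sum_range_succ]
    ring

/-- **Corollary 2 (abstract version).**
If for infinitely many `T` the stepsize schedule takes a long step (`η T ≥ 2/L`,
`∑_{t<T} η t ≥ 1/L`) with ratio `η T / ∑_{t<T} η t ≥ c > 0`, then no anytime error
bound `f (x T) - f x* ≤ φ T · L (x₀ - x*)²` with `φ T → 0` can hold uniformly over
convex `L`-smooth functions. -/
theorem gd_frequent_long_steps_no_anytime_bound
    (L : ℝ) (hL : 0 < L) (η : ℕ → ℝ) (hη : ∀ t, 0 ≤ η t)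
    (c : ℝ) (hc : 0 < c)
    (hfreq : ∃ᶠ T in Filter.atTop,
      2 / L ≤ η T ∧ 1 / L ≤ ∑ t ∈ Finset.range T, η t ∧
        c ≤ η T / ∑ t ∈ Finset.range T, η t) :
    ∀ φ : ℕ → ℝ, Filter.Tendsto φ Filter.atTop (nhds 0) →
      ¬ (∀ f : ℝ → ℝ, ConvexOn ℝ Set.univ f → Differentiable ℝ f →
          (∀ y z : ℝ, |deriv f y - deriv f z| ≤ L * |y - z|) →
          ∀ xstar : ℝ, (∀ y : ℝ, f xstar ≤ f y) →
          ∀ x₀ : ℝ, ∀ x : ℕ → ℝ, x 0 = x₀ →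
            (∀ t : ℕ, x (t + 1) = x t - η t * deriv f (x t)) →
            ∀ T : ℕ, f (x T) - f xstar ≤ φ T * L * (x₀ - xstar) ^ 2) := by
  intro φ hφ h
  have hev : ∀ᶠ T in Filter.atTop, φ (T + 1) < c ^ 2 / 32 :=
    ((Filter.tendsto_add_atTop_iff_nat 1).2 hφ).eventually_lt_const (by positivity)
  obtain ⟨T, ⟨hlong, hsum, hratio⟩, hsmall⟩ := (hfreq.and_eventually hev).exists
  set S := ∑ t ∈ Finset.range T, η t
  have hSpos : 0 < S := lt_of_lt_of_le (by positivity) hsum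
  rw [le_div_iff₀ hSpos] at hratio
  rw [div_le_iff₀ hL] at hlong hsum
  let x : ℕ → ℝ := fun n =>
    Nat.rec (1 + L * S) (fun t y => y - η t * deriv (oneSidedHuber L) y) n
  have hx : ∀ t, x (t + 1) = x t - η t * deriv (oneSidedHuber L) (x t) := fun _ => rfl
  have hxT : x T = 1 := by
    simpa using gd_oneSidedHuber_eq hL.le hη T (x := x) rfl hx le_rfl
  have hxT' : x (T + 1) = 1 - η T * L := by
    rw [hx, hxT, deriv_oneSidedHuber]
    simp
  have key := h (oneSidedHuber L) (convexOn_oneSidedHuber hL.le) (differentiable_oneSidedHuber L)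
    (abs_deriv_oneSidedHuber_sub_le hL.le) 0
    (fun y => (oneSidedHuber_zero L).trans_le (oneSidedHuber_nonneg hL.le y))
    (1 + L * S) x rfl hx (T + 1)
  rw [hxT', oneSidedHuber_zero, oneSidedHuber_of_nonpos L (by linarith), sub_zero, sub_zero] at key
  have hlower : (c * (L * S) / 2) ^ 2 ≤ (1 - η T * L) ^ 2 := by
    rw [← neg_sq (1 - η T * L)]
    have : c * S * L ≤ η T * L := by gcongr
    gcongr
    linarith
  have hupper : φ (T + 1) * L * (1 + L * S) ^ 2 < c ^ 2 / 32 * L * (2 * (L * S)) ^ 2 := by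
    calc φ (T + 1) * L * (1 + L * S) ^ 2 < c ^ 2 / 32 * L * (1 + L * S) ^ 2 := by gcongr
      _ ≤ c ^ 2 / 32 * L * (2 * (L * S)) ^ 2 := by
        gcongr
        linarith
  have hscaled := mul_le_mul_of_nonneg_left hlower (half_pos hL).le
  linarith
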